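/- Let p : ℕ → [0,1] be such that n·p(n)/(log n)² → ∞ and n·(1−p(n))/(log n)² → ∞. Then for all sufficiently large n, the probability that G ~ G_{n,p(n)} is not (p(n), (3/2)·√(n·p(n)·(1−p(n))))-jumbled is at most 2/n². -/

import Mathlib

open scoped Classical
open SimpleGraph

namespace EDHC

/-- Degree of a vertex (as cardinality of its neighbour set). -/
noncomputable def deg {V : Type} (G : SimpleGraph V) (v : V) : ℕ := (G.neighborSet v).ncard

/-- Minimum degree. -/
noncomputable def minDeg {V : Type} (G : SimpleGraph V) : ℕ := sInf (Set.range (deg G))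

/-- Maximum degree. -/
noncomputable def maxDeg {V : Type} (G : SimpleGraph V) : ℕ := sSup (Set.range (deg G))

/-- Number of edges of `G` with both endpoints in `S`. -/
noncomputable def eIn {V : Type} (G : SimpleGraph V) (S : Set V) : ℕ :=
  {e ∈ G.edgeSet | ∀ v ∈ e, v ∈ S}.ncard

/-- Number of edges of `G` with one endpoint in `S` and the other in `T`. -/
noncomputable def eBtw {V : Type} (G : SimpleGraph V) (S T : Set V) : ℕ :=
  {e ∈ G.edgeSet | ∃ a ∈ S, ∃ b ∈ T, e = s(a, b)}.ncard

/-- `G` is `(p, β)`-jumbled. -/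
def IsJumbled {V : Type} (G : SimpleGraph V) (p β : ℝ) : Prop :=
  ∀ S : Set V, |(eIn G S : ℝ) - p * ((S.ncard : ℝ) * ((S.ncard : ℝ) - 1) / 2)| ≤ β * S.ncard

/-- `G` is strongly `2`-jumping. -/
def StronglyTwoJumping (n : ℕ) (G : SimpleGraph (Fin n)) : Prop :=
  ∀ T : Set (Fin n), T.Nonempty →
    (∑ v ∈ (Set.toFinite T).toFinset, (deg G v : ℝ)) / (T.ncard : ℝ) ≥
      (minDeg G : ℝ) + min ((T.ncard : ℝ) - 1) ((Real.log n) ^ 2)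

/-- `G` is `p`-pseudorandom. -/
def IsPseudorandom (n : ℕ) (G : SimpleGraph (Fin n)) (p : ℝ) : Prop :=
  IsJumbled G p (2 * Real.sqrt (n * p * (1 - p))) ∧
  (∀ S T : Set (Fin n), Disjoint S T →
    ((1 / (S.ncard : ℝ) + 1 / (T.ncard : ℝ)) * Real.log n / p ≥ 7 / 2 →
      (eBtw G S T : ℝ) ≤ 2 * ((S.ncard : ℝ) + (T.ncard : ℝ)) * Real.log n) ∧
    ((1 / (S.ncard : ℝ) + 1 / (T.ncard : ℝ)) * Real.log n / p ≤ 7 / 2 →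
      (eBtw G S T : ℝ) ≤ 7 * (S.ncard : ℝ) * (T.ncard : ℝ) * p)) ∧
  (∀ S : Set (Fin n),
    (Real.log n / ((S.ncard : ℝ) * p) ≥ 7 / 4 → (eIn G S : ℝ) ≤ 2 * (S.ncard : ℝ) * Real.log n) ∧
    (Real.log n / ((S.ncard : ℝ) * p) ≤ 7 / 4 → (eIn G S : ℝ) ≤ 7 * (S.ncard : ℝ) ^ 2 * p / 2)) ∧
  ((n : ℝ) * p - 2 * Real.sqrt ((n : ℝ) * p * Real.log n) ≤ (minDeg G : ℝ) ∧
    (minDeg G : ℝ) ≤ (n : ℝ) * p - 200 * Real.sqrt ((n : ℝ) * p * (1 - p)) ∧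
    (maxDeg G : ℝ) ≤ (n : ℝ) * p + 2 * Real.sqrt ((n : ℝ) * p * Real.log n)) ∧
  StronglyTwoJumping n G

/-- `G` is `u`-jumping. -/
def IsJumping (n : ℕ) (G : SimpleGraph (Fin n)) (u : ℝ) : Prop :=
  ∃ x₀ : Fin n, deg G x₀ = minDeg G ∧
    ∀ x : Fin n, x ≠ x₀ → (deg G x : ℝ) ≥ (minDeg G : ℝ) + u

/-- `C` is a Hamilton cycle (on the whole vertex set `Fin n`). -/
def IsHamCycle {n : ℕ} (C : SimpleGraph (Fin n)) : Prop :=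
  ∃ (v : Fin n) (w : C.Walk v v), w.IsHamiltonianCycle ∧ C.edgeSet = {e | e ∈ w.edges}

/-- `G` has property `H`. -/
def HasPropertyH (n : ℕ) (G : SimpleGraph (Fin n)) : Prop :=
  ∃ HC : Fin (minDeg G / 2) → SimpleGraph (Fin n),
    (∀ i, HC i ≤ G ∧ IsHamCycle (HC i)) ∧
    (∀ i j, i ≠ j → Disjoint (HC i).edgeSet (HC j).edgeSet) ∧
    (Odd (minDeg G) →
      ∃ M : SimpleGraph (Fin n), M ≤ G ∧ (∀ v, deg M v ≤ 1) ∧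
        M.edgeSet.ncard = n / 2 ∧ ∀ i, Disjoint M.edgeSet (HC i).edgeSet)

/-- Probability of the event `A` under the binomial random graph `G_{n,p}`. -/
noncomputable def gnpProb (n : ℕ) (p : ℝ) (A : SimpleGraph (Fin n) → Prop) : ℝ :=
  ∑ G : SimpleGraph (Fin n),
    if A G then p ^ G.edgeSet.ncard * (1 - p) ^ (n.choose 2 - G.edgeSet.ncard) else 0


/-- Number of cycles of a 2-regular graph = number of connected components. -/
noncomputable def numCycles {V : Type} (F : SimpleGraph V) : ℕ := Nat.card F.ConnectedComponent

/-- `N` is a perfect matching on the whole vertex set. -/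
def IsPerfectMatchingGraph {n : ℕ} (N : SimpleGraph (Fin n)) : Prop :=
  ∀ v, ((N.neighborSet v).ncard) = 1

/-- `N` is a perfect pseudomatching: one vertex of degree 2, all others of degree 1. -/
def IsPerfectPseudomatching {n : ℕ} (N : SimpleGraph (Fin n)) : Prop :=
  ∃ w, ((N.neighborSet w).ncard) = 2 ∧ ∀ v, v ≠ w → ((N.neighborSet v).ncard) = 1

/-- A set of edges forms a matching (no two distinct edges share a vertex). -/
def IsMatchingSet {n : ℕ} (E : Set (Sym2 (Fin n))) : Prop :=
  ∀ e ∈ E, ∀ f ∈ E, e ≠ f → ∀ v : Fin n, v ∈ e → v ∉ f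

/-- Number of cycles (orbits, including fixed points) of a permutation. -/
noncomputable def cycleCount {α : Type} (σ : Equiv.Perm α) : ℕ :=
  Nat.card (Quotient (⟨σ.SameCycle,
    ⟨fun x => Equiv.Perm.SameCycle.refl σ x, fun h => h.symm, fun h h' => h.trans h'⟩⟩ : Setoid α))

/-- Edges of the bipartite graph given by the relation `R` between `S` and `T`. -/
noncomputable def eBip {n : ℕ} (R : Fin n → Fin n → Prop) (S T : Set (Fin n)) : ℕ :=
  {q : Fin n × Fin n | q.1 ∈ S ∧ q.2 ∈ T ∧ R q.1 q.2}.ncard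

/-- One rotation of a path (represented as a list of vertices), with new edge from `H`
and pivot in `Q`. -/
def RotStep {V : Type} (H : SimpleGraph V) (Q : Set V) (l l' : List V) : Prop :=
  ∃ (x : V) (a : List V) (p : V) (b : List V),
    l = (x :: a) ++ p :: b ∧ l' = (x :: a).reverse ++ p :: b ∧ p ∈ Q ∧ H.Adj x p

/-- `v` is `(H, Q, τ)`-reachable from the path `l`. -/
def ReachableVert {V : Type} (H : SimpleGraph V) (Q : Set V) (τ : ℕ) (l : List V) (v : V) : Prop :=
  ∃ (k : ℕ) (f : ℕ → List V), k ≤ τ ∧ f 0 = l ∧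
    (∀ i < k, RotStep H Q (f i) (f (i + 1))) ∧ (f k).head? = some v

/-- External neighbourhood. -/
def extNbhd {V : Type} (H : SimpleGraph V) (S : Set V) : Set V :=
  (⋃ x ∈ S, H.neighborSet x) \ S

end EDHC

namespace EDHC

/-- Weight of a graph under the binomial random graph `G_{n,p}`. -/
noncomputable def gnpWeight (n : ℕ) (p : ℝ) (G : SimpleGraph (Fin n)) : ℝ :=
  p ^ G.edgeSet.ncard * (1 - p) ^ (n.choose 2 - G.edgeSet.ncard)

lemma gnpWeight_nonneg {n : ℕ} {p : ℝ} (hp0 : 0 ≤ p) (hp1 : p ≤ 1) (G : SimpleGraph (Fin n)) :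
    0 ≤ gnpWeight n p G :=
  mul_nonneg (pow_nonneg hp0 _) (pow_nonneg (sub_nonneg.2 hp1) _)

lemma gnpProb_eq_sum_weight (n : ℕ) (p : ℝ) (A : SimpleGraph (Fin n) → Prop) :
    gnpProb n p A = ∑ G : SimpleGraph (Fin n), if A G then gnpWeight n p G else 0 := rfl

/-- Markov's inequality for `gnpProb`. -/
lemma gnpProb_le_sum {n : ℕ} {p : ℝ} (hp0 : 0 ≤ p) (hp1 : p ≤ 1) {A : SimpleGraph (Fin n) → Prop}
    {f : SimpleGraph (Fin n) → ℝ} (hf : ∀ G, 0 ≤ f G) (hA : ∀ G, A G → 1 ≤ f G) :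
    gnpProb n p A ≤ ∑ G : SimpleGraph (Fin n), gnpWeight n p G * f G := by
  rw [gnpProb_eq_sum_weight]
  refine Finset.sum_le_sum fun G _ => ?_
  have hw := gnpWeight_nonneg hp0 hp1 G
  split_ifs with h
  · exact le_mul_of_one_le_right hw (hA G h)
  · exact mul_nonneg hw (hf G)

/-- The union bound for `gnpProb`. -/
lemma gnpProb_exists_le {n : ℕ} {p : ℝ} (hp0 : 0 ≤ p) (hp1 : p ≤ 1) {ι : Type} (I : Finset ι)
    {A : SimpleGraph (Fin n) → Prop} {B : ι → SimpleGraph (Fin n) → Prop}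
    (hAB : ∀ G, A G → ∃ i ∈ I, B i G) :
    gnpProb n p A ≤ ∑ i ∈ I, gnpProb n p (B i) := by
  simp only [gnpProb_eq_sum_weight]
  rw [Finset.sum_comm]
  refine Finset.sum_le_sum fun G _ => ?_
  have hw := gnpWeight_nonneg hp0 hp1 G
  have hnn : ∀ i ∈ I, 0 ≤ if B i G then gnpWeight n p G else 0 := fun i _ => by
    split_ifs <;> simp [hw]
  split_ifs with h
  · obtain ⟨i, hi, hB⟩ := hAB G h
    calc gnpWeight n p G = if B i G then gnpWeight n p G else 0 := by simp [hB]
      _ ≤ _ := Finset.single_le_sum hnn hi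
  · exact Finset.sum_nonneg hnn

/-- Bound for the moment generating function of a centred Bernoulli variable. -/
lemma bernoulli_mgf_le {p l : ℝ} (hp0 : 0 ≤ p) (hp1 : p ≤ 1) (hl : |l| ≤ 1) :
    (p * Real.exp l + (1 - p)) * Real.exp (-(l * p)) ≤ Real.exp (p * (1 - p) * l ^ 2) := by
  have bound : ∀ x : ℝ, |x| ≤ 1 → Real.exp x ≤ 1 + x + x ^ 2 := fun x hx => by
    linarith [(abs_le.1 (Real.abs_exp_sub_one_sub_id_le hx)).2]
  have e1 := bound (l * (1 - p)) (by
    rw [abs_mul, abs_of_nonneg (sub_nonneg.2 hp1)]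
    nlinarith [abs_nonneg l])
  have e2 := bound (-(l * p)) (by
    rw [abs_neg, abs_mul, abs_of_nonneg hp0]
    nlinarith [abs_nonneg l])
  have split : Real.exp (l * (1 - p)) = Real.exp l * Real.exp (-(l * p)) := by
    rw [← Real.exp_add]; ring_nf
  have e3 := Real.add_one_le_exp (p * (1 - p) * l ^ 2)
  have e4 := mul_le_mul_of_nonneg_left e1 hp0
  have e5 := mul_le_mul_of_nonneg_left e2 (sub_nonneg.2 hp1)
  rw [split] at e4
  nlinarith

/-- All pairs of distinct vertices with both elements in `S`. -/
noncomputable def pairsIn {n : ℕ} (S : Finset (Fin n)) : Finset (Sym2 (Fin n)) :=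
  S.offDiag.image Sym2.mk.uncurry

lemma mem_pairsIn {n : ℕ} {S : Finset (Fin n)} {e : Sym2 (Fin n)} :
    e ∈ pairsIn S ↔ ¬ e.IsDiag ∧ ∀ v ∈ e, v ∈ S := by
  induction e with
  | h a b =>
    simp only [pairsIn, Finset.mem_image, Finset.mem_offDiag, Prod.exists, Sym2.mk_isDiag_iff,
      Sym2.mem_iff, Function.uncurry]
    constructor
    · rintro ⟨x, y, ⟨hx, hy, hxy⟩, h⟩
      rcases Sym2.eq_iff.1 h with ⟨rfl, rfl⟩ | ⟨rfl, rfl⟩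
      · exact ⟨hxy, by rintro v (rfl | rfl) <;> assumption⟩
      · exact ⟨fun h => hxy h.symm, by rintro v (rfl | rfl) <;> assumption⟩
    · rintro ⟨hab, h⟩
      exact ⟨a, b, ⟨h a (Or.inl rfl), h b (Or.inr rfl), hab⟩, rfl⟩

lemma card_pairsIn {n : ℕ} (S : Finset (Fin n)) : (pairsIn S).card = S.card.choose 2 := by
  rw [pairsIn, ← Sym2.card_image_offDiag]

lemma eIn_eq_card {n : ℕ} (G : SimpleGraph (Fin n)) (S : Finset (Fin n)) :
    eIn G (S : Set (Fin n)) = (G.edgeSet.toFinset ∩ pairsIn S).card := by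
  rw [eIn, ← Set.ncard_coe_finset]
  congr 1
  ext e
  simp only [Set.mem_ofPred_eq, Finset.mem_coe, Finset.mem_inter, Set.mem_toFinset, mem_pairsIn]
  constructor
  · rintro ⟨he, h⟩
    exact ⟨he, G.not_isDiag_of_mem_edgeSet he, h⟩
  · rintro ⟨he, -, h⟩
    exact ⟨he, h⟩

lemma sum_gnpWeight_mul_exp_eIn_le {n : ℕ} {p : ℝ} (hp0 : 0 ≤ p) (hp1 : p ≤ 1) (l : ℝ)
    (S : Finset (Fin n)) :
    ∑ G : SimpleGraph (Fin n), gnpWeight n p G * Real.exp (l * eIn G (S : Set (Fin n))) ≤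
      (p * Real.exp l + (1 - p)) ^ S.card.choose 2 := by
  set U := pairsIn (Finset.univ : Finset (Fin n)) with hU
  have hUcard : U.card = n.choose 2 := by rw [hU, card_pairsIn, Finset.card_fin]
  have hSU : pairsIn S ⊆ U := fun e he => by
    rw [hU, mem_pairsIn]; exact ⟨(mem_pairsIn.1 he).1, by simp⟩
  have hGU : ∀ G : SimpleGraph (Fin n), G.edgeSet.toFinset ⊆ U := fun G e he => by
    rw [hU, mem_pairsIn]
    exact ⟨G.not_isDiag_of_mem_edgeSet (Set.mem_toFinset.1 he), by simp⟩
  let f : Sym2 (Fin n) → ℝ := fun e => p * if e ∈ pairsIn S then Real.exp l else 1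
  have hf : ∀ e, 0 ≤ f e := fun e => mul_nonneg hp0 (by split_ifs <;> positivity)
  let F : Finset (Sym2 (Fin n)) → ℝ := fun E => (∏ e ∈ E, f e) * ∏ _e ∈ U \ E, (1 - p)
  have hF : ∀ E, 0 ≤ F E := fun E =>
    mul_nonneg (Finset.prod_nonneg fun e _ => hf e)
      (Finset.prod_nonneg fun _ _ => sub_nonneg.2 hp1)
  have hterm : ∀ G : SimpleGraph (Fin n),
      gnpWeight n p G * Real.exp (l * eIn G (S : Set (Fin n))) = F G.edgeSet.toFinset := by
    intro G
    have hc : G.edgeSet.ncard = G.edgeSet.toFinset.card := Set.ncard_eq_toFinset_card' _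
    simp only [F, f, gnpWeight, Finset.prod_const, Finset.prod_mul_distrib]
    rw [Finset.card_sdiff_of_subset (hGU G), hUcard, hc, eIn_eq_card, Finset.prod_ite,
      Finset.prod_const, Finset.prod_const_one, Finset.filter_mem_eq_inter, mul_comm l,
      Real.exp_nat_mul]
    ring
  calc ∑ G : SimpleGraph (Fin n), gnpWeight n p G * Real.exp (l * eIn G (S : Set (Fin n)))
      = ∑ G : SimpleGraph (Fin n), F G.edgeSet.toFinset :=
        Finset.sum_congr rfl fun G _ => hterm G
    _ = ∑ E ∈ Finset.univ.image fun G : SimpleGraph (Fin n) => G.edgeSet.toFinset, F E := by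
        rw [Finset.sum_image]
        intro G _ H _ h
        exact SimpleGraph.edgeSet_injective (Set.toFinset_inj.1 h)
    _ ≤ ∑ E ∈ U.powerset, F E := by
        refine Finset.sum_le_sum_of_subset_of_nonneg ?_ fun E _ _ => hF E
        intro E hE
        obtain ⟨G, -, rfl⟩ := Finset.mem_image.1 hE
        exact Finset.mem_powerset.2 (hGU G)
    _ = ∏ e ∈ U, (f e + (1 - p)) := (Finset.prod_add _ _ _).symm
    _ = ∏ e ∈ U, if e ∈ pairsIn S then p * Real.exp l + (1 - p) else 1 := by
        refine Finset.prod_congr rfl fun e _ => ?_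
        simp only [f]
        split_ifs <;> ring
    _ = (p * Real.exp l + (1 - p)) ^ S.card.choose 2 := by
        rw [Finset.prod_ite, Finset.prod_const, Finset.prod_const_one,
          Finset.filter_mem_eq_inter, Finset.inter_eq_right.2 hSU, card_pairsIn, mul_one]

lemma sum_gnpWeight_mul_exp_centred_le {n : ℕ} {p l : ℝ} (hp0 : 0 ≤ p) (hp1 : p ≤ 1)
    (hl : |l| ≤ 1) (S : Finset (Fin n)) :
    ∑ G : SimpleGraph (Fin n), gnpWeight n p G *
        Real.exp (l * (eIn G (S : Set (Fin n)) - p * (S.card.choose 2 : ℕ))) ≤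
      Real.exp (p * (1 - p) * l ^ 2 * (S.card.choose 2 : ℕ)) := by
  set N := S.card.choose 2
  have hsplit : ∀ x : ℝ, Real.exp (l * (x - p * N)) =
      Real.exp (l * x) * Real.exp (-(l * p)) ^ N := fun x => by
    rw [← Real.exp_nat_mul, ← Real.exp_add]; ring_nf
  simp only [hsplit, ← mul_assoc]
  rw [← Finset.sum_mul]
  calc _ ≤ (p * Real.exp l + (1 - p)) ^ N * Real.exp (-(l * p)) ^ N :=
        mul_le_mul_of_nonneg_right (sum_gnpWeight_mul_exp_eIn_le hp0 hp1 l S) (by positivity)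
    _ = ((p * Real.exp l + (1 - p)) * Real.exp (-(l * p))) ^ N := (mul_pow _ _ _).symm
    _ ≤ Real.exp (p * (1 - p) * l ^ 2) ^ N := by
        refine pow_le_pow_left₀ ?_ (bernoulli_mgf_le hp0 hp1 hl) N
        have := sub_nonneg.2 hp1
        positivity
    _ = _ := by rw [← Real.exp_nat_mul]; ring_nf

/-- Chernoff bound for the number of edges inside a fixed vertex set. -/
lemma gnpProb_abs_eIn_sub_le {n : ℕ} {p l : ℝ} (hp0 : 0 ≤ p) (hp1 : p ≤ 1) (hl0 : 0 ≤ l)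
    (hl1 : l ≤ 1) (S : Finset (Fin n)) (t : ℝ) :
    gnpProb n p (fun G => t < |(eIn G (S : Set (Fin n)) : ℝ) - p * (S.card.choose 2 : ℕ)|) ≤
      2 * Real.exp (p * (1 - p) * l ^ 2 * (S.card.choose 2 : ℕ) - l * t) := by
  set N := S.card.choose 2
  let d : SimpleGraph (Fin n) → ℝ := fun G => eIn G (S : Set (Fin n)) - p * N
  have h₁ := sum_gnpWeight_mul_exp_centred_le (l := l) hp0 hp1 (abs_le.2 ⟨by linarith, hl1⟩) S
  have h₂ := sum_gnpWeight_mul_exp_centred_le (l := -l) hp0 hp1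
    (abs_le.2 ⟨by linarith, by linarith⟩) S
  rw [neg_sq] at h₂
  calc _ ≤ ∑ G : SimpleGraph (Fin n), gnpWeight n p G *
          ((Real.exp (l * d G) + Real.exp (-l * d G)) * Real.exp (-(l * t))) := by
        refine gnpProb_le_sum hp0 hp1 (fun G => by positivity) fun G hG => ?_
        rw [add_mul, ← Real.exp_add, ← Real.exp_add]
        rcases lt_abs.1 hG with h | h
        · have : 1 ≤ Real.exp (l * d G + -(l * t)) :=
            Real.one_le_exp (by nlinarith [mul_le_mul_of_nonneg_left h.le hl0])
          linarith [Real.exp_pos (-l * d G + -(l * t))]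
        · have : 1 ≤ Real.exp (-l * d G + -(l * t)) :=
            Real.one_le_exp (by nlinarith [mul_le_mul_of_nonneg_left h.le hl0])
          linarith [Real.exp_pos (l * d G + -(l * t))]
    _ = (∑ G : SimpleGraph (Fin n), gnpWeight n p G * Real.exp (l * d G) +
          ∑ G : SimpleGraph (Fin n), gnpWeight n p G * Real.exp (-l * d G)) *
            Real.exp (-(l * t)) := by
        rw [← Finset.sum_add_distrib, Finset.sum_mul]
        exact Finset.sum_congr rfl fun G _ => by ring
    _ ≤ (2 * Real.exp (p * (1 - p) * l ^ 2 * N)) * Real.exp (-(l * t)) :=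
        mul_le_mul_of_nonneg_right (by linarith) (Real.exp_pos _).le
    _ = _ := by rw [mul_assoc, ← Real.exp_add, ← sub_eq_add_neg]

lemma gnpProb_abs_eIn_sub_sqrt_le {n : ℕ} {p : ℝ} (hp0 : 0 ≤ p) (hp1 : p ≤ 1) (hn : 0 < n)
    (S : Finset (Fin n)) :
    gnpProb n p (fun G => 3 / 2 * √(n * p * (1 - p)) * S.card <
        |(eIn G (S : Set (Fin n)) : ℝ) - p * (S.card.choose 2 : ℕ)|) ≤
      2 * (Real.exp (-(9 / 8 * n)) + Real.exp (-(3 / 4 * √(n * p * (1 - p)))) ^ S.card) := by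
  have hq : 0 ≤ 1 - p := sub_nonneg.2 hp1
  have hn' : (0 : ℝ) < n := Nat.cast_pos.2 hn
  set y := √(n * p * (1 - p)) with hy
  have hy0 : 0 ≤ y := Real.sqrt_nonneg _
  have hysq : y ^ 2 = n * (p * (1 - p)) := by
    rw [hy, Real.sq_sqrt (by positivity), mul_assoc]
  have hpq : p * (1 - p) = y ^ 2 / n := by rw [hysq]; field_simp
  set s : ℝ := (S.card : ℝ) with hs
  have hs0 : 0 ≤ s := Nat.cast_nonneg _
  have hN : ((S.card.choose 2 : ℕ) : ℝ) ≤ s ^ 2 / 2 := by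
    rw [Nat.cast_choose_two, ← hs]; nlinarith
  rw [← Real.exp_nat_mul, ← hs]
  have key : ∀ l : ℝ, p * (1 - p) * l ^ 2 * (S.card.choose 2 : ℕ) ≤ (l * s * y) ^ 2 / (2 * n) := by
    intro l
    calc _ ≤ p * (1 - p) * l ^ 2 * (s ^ 2 / 2) := by gcongr
      _ = _ := by rw [hpq]; field_simp
  by_cases hcase : s * y ≤ 3 / 2 * n
  · refine (gnpProb_abs_eIn_sub_le hp0 hp1 zero_le_one le_rfl S _).trans ?_
    gcongr
    refine le_add_of_nonneg_of_le (Real.exp_pos _).le (Real.exp_le_exp.2 ?_)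
    have h := key 1
    have : (1 * s * y) ^ 2 / (2 * n) ≤ 3 / 4 * (s * y) := by
      rw [div_le_iff₀ (by positivity)]
      nlinarith [mul_nonneg hs0 hy0]
    linarith
  · push Not at hcase
    have hsy : 0 < s * y := lt_trans (by positivity) hcase
    refine (gnpProb_abs_eIn_sub_le (l := 3 / 2 * n / (s * y)) hp0 hp1
      (div_nonneg (mul_nonneg (by norm_num) hn'.le) hsy.le)
      ((div_le_one hsy).2 hcase.le) S _).trans ?_
    gcongr
    refine le_add_of_le_of_nonneg (Real.exp_le_exp.2 ?_) (Real.exp_pos _).le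
    have h := key (3 / 2 * n / (s * y))
    have e1 : 3 / 2 * n / (s * y) * s * y = 3 / 2 * n := by
      rw [mul_assoc, div_mul_cancel₀ _ hsy.ne']
    have e2 : 3 / 2 * n / (s * y) * (3 / 2 * y * s) = 9 / 4 * n := by
      calc _ = 3 / 2 * (3 / 2 * n / (s * y) * s * y) := by ring
        _ = _ := by rw [e1]; ring
    have e3 : (3 / 2 * (n : ℝ)) ^ 2 / (2 * n) = 9 / 8 * n := by
      rw [div_eq_iff (by positivity)]; ring
    rw [e1, e3] at h
    linarith

lemma gnpProb_not_isJumbled_le {n : ℕ} {p : ℝ} (hp0 : 0 ≤ p) (hp1 : p ≤ 1) (hn : 0 < n) :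
    gnpProb n p (fun G => ¬ IsJumbled G p (3 / 2 * √(n * p * (1 - p)))) ≤
      2 * ((2 * Real.exp (-(9 / 8))) ^ n +
        ((1 + Real.exp (-(3 / 4 * √(n * p * (1 - p))))) ^ n - 1)) := by
  set y := √(n * p * (1 - p))
  set x := Real.exp (-(3 / 4 * y))
  have hx : ∑ S : Finset (Fin n), x ^ S.card = (1 + x) ^ n := by
    have h := Finset.sum_pow_mul_eq_add_pow x 1 (Finset.univ : Finset (Fin n))
    simpa [add_comm] using h
  have hexp : Real.exp (-(9 / 8 * n)) = Real.exp (-(9 / 8)) ^ n := by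
    rw [← Real.exp_nat_mul]; ring_nf
  calc _ ≤ ∑ S ∈ (Finset.univ : Finset (Finset (Fin n))).erase ∅,
        gnpProb n p (fun G => 3 / 2 * y * S.card <
          |(eIn G (S : Set (Fin n)) : ℝ) - p * (S.card.choose 2 : ℕ)|) := by
        refine gnpProb_exists_le hp0 hp1 _ fun G hG => ?_
        simp only [IsJumbled, not_forall, not_le] at hG
        obtain ⟨S, hS⟩ := hG
        lift S to Finset (Fin n) using S.toFinite
        rw [Set.ncard_coe_finset, ← Nat.cast_choose_two] at hS
        refine ⟨S, Finset.mem_erase.2 ⟨?_, Finset.mem_univ _⟩, hS⟩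
        rintro rfl
        rw [eIn_eq_card] at hS
        simp [pairsIn] at hS
    _ ≤ ∑ S ∈ (Finset.univ : Finset (Finset (Fin n))).erase ∅,
        2 * (Real.exp (-(9 / 8 * n)) + x ^ S.card) :=
        Finset.sum_le_sum fun S _ => gnpProb_abs_eIn_sub_sqrt_le hp0 hp1 hn S
    _ = 2 * (∑ S : Finset (Fin n), (Real.exp (-(9 / 8 * n)) + x ^ S.card) -
          (Real.exp (-(9 / 8 * n)) + 1)) := by
        rw [← Finset.mul_sum, Finset.sum_erase_eq_sub (Finset.mem_univ _)]
        simp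
    _ ≤ _ := by
        rw [Finset.sum_add_distrib, hx, mul_pow, ← hexp]
        simp only [Finset.sum_const, Finset.card_univ, Fintype.card_finset, Fintype.card_fin,
          nsmul_eq_mul, Nat.cast_pow, Nat.cast_ofNat]
        linarith [Real.exp_pos (-(9 / 8 * (n : ℝ)))]

lemma exp_neg_sqrt_variance_le {n : ℕ} {p : ℝ} (hp0 : 0 ≤ p) (hp1 : p ≤ 1) (hn : 0 < n)
    (h1 : 72 * Real.log n ^ 2 ≤ n * p) (h2 : 72 * Real.log n ^ 2 ≤ n * (1 - p)) :
    Real.exp (-(3 / 4 * √(n * p * (1 - p)))) ≤ 1 / (n : ℝ) ^ 4 := by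
  have hn' : (0 : ℝ) < n := Nat.cast_pos.2 hn
  have hsq : (6 * Real.log n) ^ 2 ≤ n * p * (1 - p) := by
    rcases le_total p (1 / 2) with h | h
    · nlinarith [mul_nonneg hn'.le hp0]
    · nlinarith [mul_nonneg hn'.le (sub_nonneg.2 hp1)]
  have hy := Real.le_sqrt_of_sq_le hsq
  have hlog : 0 ≤ Real.log n := Real.log_natCast_nonneg n
  calc _ ≤ Real.exp (-((4 : ℕ) * Real.log n)) := Real.exp_le_exp.2 (by push_cast; linarith)
    _ = _ := by rw [Real.exp_neg, Real.exp_nat_mul, Real.exp_log hn', one_div]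

lemma one_add_pow_sub_one_le {n : ℕ} (hn : 4 ≤ n) {x : ℝ} (hx0 : 0 ≤ x)
    (hx : x ≤ 1 / (n : ℝ) ^ 4) : (1 + x) ^ n - 1 ≤ 1 / (2 * (n : ℝ) ^ 2) := by
  have hn' : (4 : ℝ) ≤ n := by exact_mod_cast hn
  set z : ℝ := n * x
  have hz0 : 0 ≤ z := by positivity
  have hz : z ≤ 1 / (n : ℝ) ^ 3 := by
    calc z ≤ n * (1 / (n : ℝ) ^ 4) := mul_le_mul_of_nonneg_left hx (by positivity)
      _ = _ := by field_simp
  have hz' : 1 / (n : ℝ) ^ 3 ≤ 1 / (4 * (n : ℝ) ^ 2) := by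
    apply one_div_le_one_div_of_le (by positivity)
    nlinarith [sq_nonneg (n : ℝ)]
  have hz1 : z ≤ 1 := hz.trans (by
    rw [div_le_one (by positivity)]; exact one_le_pow₀ (by linarith))
  have hexp := (abs_le.1 (Real.abs_exp_sub_one_sub_id_le (abs_le.2 ⟨by linarith, hz1⟩))).2
  have hpow : (1 + x) ^ n ≤ Real.exp z := by
    rw [Real.exp_nat_mul]
    exact pow_le_pow_left₀ (by positivity) (by linarith [Real.add_one_le_exp x]) n
  have : 2 * (1 / (4 * (n : ℝ) ^ 2)) = 1 / (2 * (n : ℝ) ^ 2) := by field_simp; norm_num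
  nlinarith

lemma eventually_two_mul_exp_pow_le :
    ∀ᶠ n : ℕ in Filter.atTop, (2 * Real.exp (-(9 / 8))) ^ n ≤ 1 / (2 * (n : ℝ) ^ 2) := by
  have hr : 2 * Real.exp (-(9 / 8)) < 1 := by
    rw [Real.exp_neg, ← div_eq_mul_inv, div_lt_one (Real.exp_pos _)]
    linarith [Real.add_one_le_exp (9 / 8 : ℝ)]
  have h := tendsto_pow_const_mul_const_pow_of_lt_one 2 (by positivity) hr
  filter_upwards [h.eventually (ge_mem_nhds (show (0 : ℝ) < 1 / 2 by norm_num)),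
    Filter.eventually_gt_atTop 0] with n hn hpos
  have : (0 : ℝ) < n := Nat.cast_pos.2 hpos
  rw [le_div_iff₀ (by positivity)]
  linarith

end EDHC

open EDHC in
/-- Lemma 4.2: whp-type bound for jumbledness of `G_{n,p}`. -/
theorem stmt_3 (p : ℕ → ℝ) (hp : ∀ n, 0 ≤ p n ∧ p n ≤ 1)
    (h1 : Filter.Tendsto (fun n : ℕ => (n : ℝ) * p n / (Real.log n) ^ 2)
      Filter.atTop Filter.atTop)
    (h2 : Filter.Tendsto (fun n : ℕ => (n : ℝ) * (1 - p n) / (Real.log n) ^ 2)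
      Filter.atTop Filter.atTop) :
    ∃ N : ℕ, ∀ n : ℕ, N ≤ n →
      gnpProb n (p n)
          (fun G => ¬ IsJumbled G (p n) (3 / 2 * Real.sqrt ((n : ℝ) * p n * (1 - p n))))
        ≤ 2 / (n : ℝ) ^ 2 := by
  rw [← Filter.eventually_atTop]
  filter_upwards [h1.eventually_ge_atTop 72, h2.eventually_ge_atTop 72,
    eventually_two_mul_exp_pow_le, Filter.eventually_ge_atTop 4] with n hn1 hn2 hn3 hn4
  obtain ⟨hp0, hp1⟩ := hp n
  have hn : 0 < n := by omega
  have hlog : 0 < Real.log n := Real.log_pos (by exact_mod_cast (by omega : 1 < n))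
  rw [le_div_iff₀ (by positivity)] at hn1 hn2
  have hx := exp_neg_sqrt_variance_le hp0 hp1 hn hn1 hn2
  have hpow := one_add_pow_sub_one_le hn4 (Real.exp_pos _).le hx
  have hsum : 2 * (1 / (2 * (n : ℝ) ^ 2) + 1 / (2 * (n : ℝ) ^ 2)) = 2 / (n : ℝ) ^ 2 := by
    field_simp; norm_num
  linarith [gnpProb_not_isJumbled_le hp0 hp1 hn]
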